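/- arXiv:2406.17365 — 6 statements merged into one kernel-verified Lean document; each statement's English description precedes it below -/
import Mathlib

section
/- Let τ be a complex number with Re(τ) > 0 and let s be a complex number with Re(s) > 1. Then the completed Riemann zeta function satisfies Λ(s) = τ^{s/2}·∫_{0}^{∞} x^{s/2 - 1}·ψ(τx) dx; that is, the classical Mellin integral representation of Λ remains valid when the ray of integration is rotated to pass through τ. -/
open MeasureTheory Complex Real

/-- For `Re z > 0`, `ψ z = ∑_{n ≥ 1} exp (-π n² z)`. -/
noncomputable def psiC (z : ℂ) : ℂ := ∑' n : ℕ, Complex.exp (-(π : ℂ) * ((n : ℂ) + 1) ^ 2 * z)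

lemma norm_ofReal_cpow_mul_exp_neg_mul (a z : ℂ) {x : ℝ} (hx : 0 < x) :
    ‖(x : ℂ) ^ (a - 1) * Complex.exp (-(z * x))‖ = x ^ (a.re - 1) * Real.exp (-(z.re * x)) := by
  rw [norm_mul, norm_cpow_eq_rpow_re_of_pos hx, Complex.norm_exp]
  simp

lemma integrableOn_cpow_mul_exp_neg_mul_Ioi {a z : ℂ} (ha : 0 < a.re) (hz : 0 < z.re) :
    IntegrableOn (fun x : ℝ ↦ (x : ℂ) ^ (a - 1) * Complex.exp (-(z * x))) (Set.Ioi 0) := by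
  have h := integrableOn_rpow_mul_exp_neg_mul_rpow (p := 1) (s := a.re - 1) (by linarith)
    one_pos hz
  refine Integrable.mono' h ?_ ?_
  · refine ContinuousOn.aestronglyMeasurable (fun x hx ↦ ContinuousAt.continuousWithinAt ?_)
      measurableSet_Ioi
    exact (continuousAt_ofReal_cpow_const _ _ (Or.inr hx.ne')).mul (by fun_prop)
  · refine (ae_restrict_iff' measurableSet_Ioi).2 (.of_forall fun x hx ↦ ?_)
    rw [norm_ofReal_cpow_mul_exp_neg_mul a z hx]
    simp

lemma differentiableAt_integral_cpow_mul_exp_neg_mul_Ioi {a z : ℂ} (ha : 0 < a.re)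
    (hz : 0 < z.re) :
    DifferentiableAt ℂ
      (fun w : ℂ ↦ ∫ x in Set.Ioi (0 : ℝ), (x : ℂ) ^ (a - 1) * Complex.exp (-(w * x))) z := by
  have ha1 : 0 < (a + 1).re := by simp; linarith
  have hball : ∀ w ∈ Metric.ball z (z.re / 2), z.re / 2 < w.re := fun w hw ↦ by
    have h1 := (Complex.abs_re_le_norm (w - z)).trans_lt (mem_ball_iff_norm.1 hw)
    have h2 := (abs_lt.1 h1).1
    rw [sub_re] at h2
    linarith
  have hbound := (integrableOn_cpow_mul_exp_neg_mul_Ioi (z := (z.re / 2 : ℝ)) ha1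
    (by simpa using hz)).norm
  refine (hasDerivAt_integral_of_dominated_loc_of_deriv_le
    (μ := volume.restrict (Set.Ioi 0))
    (F := fun w (x : ℝ) ↦ (x : ℂ) ^ (a - 1) * Complex.exp (-(w * x)))
    (F' := fun w (x : ℝ) ↦ -((x : ℂ) ^ (a + 1 - 1) * Complex.exp (-(w * x))))
    (Metric.ball_mem_nhds z (half_pos hz)) ?_ (integrableOn_cpow_mul_exp_neg_mul_Ioi ha hz)
    (integrableOn_cpow_mul_exp_neg_mul_Ioi ha1 hz).neg.aestronglyMeasurable
    ?_ hbound ?_).2.differentiableAt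
  · filter_upwards [Metric.ball_mem_nhds z (half_pos hz)] with w hw
    exact (integrableOn_cpow_mul_exp_neg_mul_Ioi ha
      ((half_pos hz).trans (hball w hw))).aestronglyMeasurable
  · refine (ae_restrict_iff' measurableSet_Ioi).2 (.of_forall fun x hx w hw ↦ ?_)
    rw [norm_neg, norm_ofReal_cpow_mul_exp_neg_mul _ _ hx,
      norm_ofReal_cpow_mul_exp_neg_mul _ _ hx, ofReal_re]
    have hx0 : (0 : ℝ) < x := hx
    gcongr
    exact (hball w hw).le
  · refine (ae_restrict_iff' measurableSet_Ioi).2 (.of_forall fun x hx w hw ↦ ?_)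
    have hx0 : (x : ℂ) ≠ 0 := ofReal_ne_zero.2 (ne_of_gt hx)
    convert! (((hasDerivAt_id w).mul_const (x : ℂ)).neg.cexp).const_mul ((x : ℂ) ^ (a - 1)) using 1
    rw [add_sub_cancel_right, cpow_sub _ _ hx0, cpow_one]
    simp only [id, Pi.neg_apply]
    field_simp

/-- Euler's integral for the Gamma function, along a rotated ray. -/
lemma integral_cpow_mul_exp_neg_mul_Ioi_of_re_pos {a z : ℂ} (ha : 0 < a.re) (hz : 0 < z.re) :
    ∫ x in Set.Ioi (0 : ℝ), (x : ℂ) ^ (a - 1) * Complex.exp (-(z * x)) =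
      z ^ (-a) * Complex.Gamma a := by
  have hopen : IsOpen {w : ℂ | 0 < w.re} := isOpen_lt continuous_const continuous_re
  have hf : AnalyticOnNhd ℂ (fun w : ℂ ↦ ∫ x in Set.Ioi (0 : ℝ),
      (x : ℂ) ^ (a - 1) * Complex.exp (-(w * x))) {w | 0 < w.re} :=
    DifferentiableOn.analyticOnNhd (fun w hw ↦
      (differentiableAt_integral_cpow_mul_exp_neg_mul_Ioi ha hw).differentiableWithinAt) hopen
  have hg : AnalyticOnNhd ℂ (fun w : ℂ ↦ w ^ (-a) * Complex.Gamma a) {w | 0 < w.re} :=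
    DifferentiableOn.analyticOnNhd (fun w hw ↦ ((differentiableAt_id.cpow_const
      (Or.inl hw)).mul_const _).differentiableWithinAt) hopen
  refine hf.eqOn_of_preconnected_of_frequently_eq hg (convex_halfSpace_re_gt 0).isPreconnected
    (z₀ := 1) (by simp) ?_ hz
  have hreal : Filter.Tendsto (fun r : ℝ ↦ (r : ℂ)) (nhdsWithin 1 {1}ᶜ) (nhdsWithin 1 {1}ᶜ) := by
    refine tendsto_nhdsWithin_iff.2 ⟨?_, ?_⟩
    · exact (continuous_ofReal.tendsto' 1 1 ofReal_one).mono_left nhdsWithin_le_nhds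
    · filter_upwards [self_mem_nhdsWithin] with r hr
      simpa using hr
  refine hreal.frequently (Filter.Eventually.frequently ?_)
  filter_upwards [nhdsWithin_le_nhds (Ioi_mem_nhds zero_lt_one)] with r hr
  have hr0 : (0 : ℝ) < r := hr
  rw [integral_cpow_mul_exp_neg_mul_Ioi ha hr0, one_div, inv_cpow, cpow_neg]
  rw [arg_ofReal_of_nonneg hr0.le]
  exact pi_pos.ne

lemma ofReal_mul_cpow {r : ℝ} (hr : 0 < r) (z w : ℂ) : ((r : ℂ) * z) ^ w = (r : ℂ) ^ w * z ^ w := by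
  rcases eq_or_ne z 0 with rfl | hz
  · rcases eq_or_ne w 0 with rfl | hw <;> simp [*]
  have hr' : (r : ℂ) ≠ 0 := ofReal_ne_zero.2 hr.ne'
  rw [cpow_def_of_ne_zero (mul_ne_zero hr' hz), cpow_def_of_ne_zero hr', cpow_def_of_ne_zero hz,
    Complex.log_ofReal_mul hr hz, ofReal_log hr.le, ← Complex.exp_add, add_mul]

theorem rotated_mellin_representation (τ s : ℂ) (hτ : 0 < τ.re) (hs : 1 < s.re) :
    completedRiemannZeta s =
      τ ^ (s / 2) * ∫ x in Set.Ioi (0 : ℝ), (x : ℂ) ^ (s / 2 - 1) * psiC (τ * x) := by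
  have hτ0 : τ ≠ 0 := by rintro rfl; simp at hτ
  have hs0 : 0 < (s / 2).re := by rw [div_ofNat_re]; positivity
  have hc (n : ℕ) : 0 < π * ((n : ℝ) + 1) ^ 2 := by positivity
  have hz (n : ℕ) : 0 < (((π * ((n : ℝ) + 1) ^ 2 : ℝ) : ℂ) * τ).re := by
    rw [re_ofReal_mul]
    exact mul_pos (hc n) hτ
  have hsq (n : ℕ) (w : ℂ) : (((n : ℂ) + 1) ^ 2) ^ (w / 2) = ((n : ℂ) + 1) ^ w := by
    have harg : ((n : ℂ) + 1).arg = 0 := by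
      simpa using natCast_arg (n := n + 1)
    rw [← cpow_nat_mul']
    · congr 1
      push_cast
      ring
    all_goals rw [harg]; linarith [pi_pos]
  have hsum : HasSum
      (fun n : ℕ ↦ ∫ x in Set.Ioi (0 : ℝ), (x : ℂ) ^ (s / 2 - 1) *
        Complex.exp (-(((π * ((n : ℝ) + 1) ^ 2 : ℝ) : ℂ) * τ * x)))
      (∫ x in Set.Ioi (0 : ℝ), ∑' n : ℕ, (x : ℂ) ^ (s / 2 - 1) *
        Complex.exp (-(((π * ((n : ℝ) + 1) ^ 2 : ℝ) : ℂ) * τ * x))) := by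
    refine hasSum_integral_of_summable_integral_norm
      (fun n ↦ integrableOn_cpow_mul_exp_neg_mul_Ioi hs0 (hz n)) ?_
    have hp : Summable fun n : ℕ ↦ 1 / ((n : ℝ) + 1) ^ s.re := by
      exact_mod_cast (summable_nat_add_iff 1).2 (Real.summable_one_div_nat_rpow.2 hs)
    refine (hp.mul_left ((1 / (π * τ.re)) ^ (s / 2).re * Real.Gamma (s / 2).re)).congr fun n ↦ ?_
    rw [setIntegral_congr_fun measurableSet_Ioi fun x hx ↦
        norm_ofReal_cpow_mul_exp_neg_mul _ _ hx,
      Real.integral_rpow_mul_exp_neg_mul_Ioi hs0 (hz n), re_ofReal_mul]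
    have hn : (0 : ℝ) ≤ (n : ℝ) + 1 := by positivity
    have : 1 / (π * ((n : ℝ) + 1) ^ 2 * τ.re) = 1 / (π * τ.re) * (((n : ℝ) + 1) ^ 2)⁻¹ := by
      field_simp
    rw [this, mul_rpow (by positivity) (by positivity), inv_rpow (by positivity),
      ← rpow_natCast_mul hn, div_ofNat_re]
    push_cast
    rw [mul_div_cancel₀ _ two_ne_zero]
    ring
  have hpsi : ∫ x in Set.Ioi (0 : ℝ), (x : ℂ) ^ (s / 2 - 1) * psiC (τ * x) =
      ∫ x in Set.Ioi (0 : ℝ), ∑' n : ℕ, (x : ℂ) ^ (s / 2 - 1) *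
        Complex.exp (-(((π * ((n : ℝ) + 1) ^ 2 : ℝ) : ℂ) * τ * x)) := by
    congr 1 with x
    rw [psiC, ← tsum_mul_left]
    congr 1 with n
    push_cast
    ring_nf
  rw [hpsi, ← hsum.tsum_eq, ← tsum_mul_left]
  have hterm (n : ℕ) : τ ^ (s / 2) * ∫ x in Set.Ioi (0 : ℝ), (x : ℂ) ^ (s / 2 - 1) *
        Complex.exp (-(((π * ((n : ℝ) + 1) ^ 2 : ℝ) : ℂ) * τ * x)) =
      (π : ℂ) ^ (-s / 2) * Complex.Gamma (s / 2) * (1 / ((n : ℂ) + 1) ^ s) := by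
    rw [integral_cpow_mul_exp_neg_mul_Ioi_of_re_pos hs0 (hz n), ofReal_mul_cpow (hc n),
      ofReal_mul, ofReal_mul_cpow pi_pos, cpow_neg τ]
    push_cast
    rw [← neg_div, hsq, cpow_neg _ s]
    have := (cpow_ne_zero_iff (y := s / 2)).2 (Or.inl hτ0)
    field_simp
  simp_rw [hterm]
  rw [tsum_mul_left, ← zeta_eq_tsum_one_div_nat_add_one_cpow hs, zeta_eq_tsum_one_div_nat_cpow hs,
    completedZeta_eq_tsum_of_one_lt_re hs]
end

section
/- Let τ be a complex number with Re(τ) > 0 and let s be a complex number with Re(s) > 1. Then ∫_{0}^{1} (τu)^{s/2}·ψ(τu) du/u = -τ^{s/2}/s - τ^{-(1-s)/2}/(1-s) + ∫_{1}^{∞} (y/τ)^{(1-s)/2}·ψ(y/τ) dy/y. -/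
open MeasureTheory Complex Real

theorem inv_re_pos {z : ℂ} (hz : 0 < z.re) : 0 < (z⁻¹).re := by
  have hz0 : z ≠ 0 := by rintro rfl; simp at hz
  rw [inv_re]; exact div_pos hz (normSq_pos.mpr hz0)

theorem psiC_eq_jacobiTheta {z : ℂ} (hz : 0 < z.re) : psiC z = (jacobiTheta (I * z) - 1) / 2 := by
  have h := hasSum_nat_jacobiTheta (τ := I * z) (by simpa using hz)
  rw [← h.tsum_eq, psiC]
  congr 1
  ext n
  congr 1
  linear_combination (-(π : ℂ) * ((n : ℂ) + 1) ^ 2 * z) * I_mul_I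

theorem psiC_functional_equation {z : ℂ} (hz : 0 < z.re) :
    psiC z = z ^ (-(1 / 2) : ℂ) / 2 - 1 / 2 + z ^ (-(1 / 2) : ℂ) * psiC z⁻¹ := by
  have hz0 : z ≠ 0 := by rintro rfl; simp at hz
  have hz' := inv_re_pos hz
  have h := jacobiTheta_S_smul ⟨I * z, by simpa using hz⟩
  have e1 : (-(I * z))⁻¹ = I * z⁻¹ := by
    rw [inv_neg, mul_inv, inv_I]; ring
  have e2 : -I * (I * z) = z := by linear_combination (-z) * I_mul_I
  rw [UpperHalfPlane.modular_S_smul] at h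
  simp only [e1, e2] at h
  have hne : z ^ (1 / 2 : ℂ) ≠ 0 := by simp [cpow_eq_zero_iff, hz0]
  rw [psiC_eq_jacobiTheta hz, psiC_eq_jacobiTheta hz', h, cpow_neg]
  field_simp
  ring

theorem mul_ofReal_cpow_of_pos {z : ℂ} (hz : z ≠ 0) {u : ℝ} (hu : 0 < u) (w : ℂ) :
    (z * u) ^ w = z ^ w * (u : ℂ) ^ w := by
  have hu' : (u : ℂ) ≠ 0 := ofReal_ne_zero.mpr hu.ne'
  rw [cpow_def_of_ne_zero (mul_ne_zero hz hu'), cpow_def_of_ne_zero hz, cpow_def_of_ne_zero hu',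
    mul_comm z, log_ofReal_mul hu hz, ← Complex.exp_add, ← ofReal_log hu.le]
  ring_nf

theorem continuousOn_psiC : ContinuousOn psiC {z | 0 < z.re} := by
  have h : ContinuousOn (fun z => (jacobiTheta (I * z) - 1) / 2) {z | 0 < z.re} := by
    intro z hz
    have h1 : ContinuousAt jacobiTheta (I * z) :=
      continuousAt_jacobiTheta (by simpa using hz)
    have h2 : ContinuousAt (fun z : ℂ => jacobiTheta (I * z)) z :=
      ContinuousAt.comp (f := fun z : ℂ => I * z) h1 (by fun_prop)
    exact ((h2.sub continuousAt_const).div_const 2).continuousWithinAt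
  exact h.congr fun z hz => psiC_eq_jacobiTheta hz

theorem norm_psiC_le {z : ℂ} (hz : 0 < z.re) :
    ‖psiC z‖ ≤ 1 / (1 - Real.exp (-π * z.re)) * Real.exp (-π * z.re) := by
  have h := norm_jacobiTheta_sub_one_le (τ := I * z) (by simpa using hz)
  rw [psiC_eq_jacobiTheta hz, norm_div, Complex.norm_two]
  have e : (I * z).im = z.re := by simp
  rw [e] at h
  calc _ ≤ (2 / (1 - Real.exp (-π * z.re)) * Real.exp (-π * z.re)) / 2 := by gcongr
    _ = _ := by ring

theorem integrableOn_cpow_mul_psiC {z : ℂ} (hz : 0 < z.re) (w : ℂ) :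
    IntegrableOn (fun y : ℝ => (y : ℂ) ^ w * psiC (y * z)) (Set.Ioi 1) := by
  have hre (y : ℝ) : ((y : ℂ) * z).re = y * z.re := by simp
  have hcont : ContinuousOn (fun y : ℝ => (y : ℂ) ^ w * psiC (y * z)) (Set.Ici 1) := by
    intro y hy
    have hy0 : 0 < y := zero_lt_one.trans_le hy
    refine ContinuousAt.continuousWithinAt (ContinuousAt.mul ?_ ?_)
    · exact continuousAt_ofReal_cpow_const _ _ (Or.inr hy0.ne')
    · have ho : IsOpen {z : ℂ | 0 < z.re} := isOpen_lt continuous_const continuous_re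
      refine ContinuousAt.comp (f := fun y : ℝ => (y : ℂ) * z) (g := psiC) ?_ (by fun_prop)
      exact continuousOn_psiC.continuousAt (ho.mem_nhds
        (by simp only [Set.mem_ofPred_eq, hre]; positivity))
  have hO : (fun y : ℝ => (y : ℂ) ^ w * psiC (y * z)) =O[Filter.atTop]
      fun y => Real.exp (-(π * z.re / 2) * y) := by
    have h1 : (fun y : ℝ => psiC (y * z)) =O[Filter.atTop] fun y => Real.exp (-(π * z.re) * y) := by
      refine Asymptotics.IsBigO.of_bound (1 / (1 - Real.exp (-π * z.re))) ?_
      filter_upwards [Filter.eventually_ge_atTop 1] with y hy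
      have hy0 : 0 < y := zero_lt_one.trans_le hy
      have hlt : Real.exp (-π * z.re) < 1 := by
        rw [Real.exp_lt_one_iff]; nlinarith [mul_pos Real.pi_pos hz]
      refine (norm_psiC_le (by rw [hre]; positivity)).trans ?_
      rw [hre, Real.norm_eq_abs, Real.abs_exp]
      have e : -π * (y * z.re) = -(π * z.re) * y := by ring
      rw [e]
      have hle : Real.exp (-(π * z.re) * y) ≤ Real.exp (-π * z.re) := by
        apply Real.exp_le_exp.mpr; nlinarith [mul_pos Real.pi_pos hz]
      have : 0 < 1 - Real.exp (-π * z.re) := by linarith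
      gcongr
    have h2 : (fun y : ℝ => (y : ℂ) ^ w) =O[Filter.atTop]
        fun y => Real.exp (π * z.re / 2 * y) := by
      refine Asymptotics.IsBigO.trans ?_
        (isLittleO_rpow_exp_pos_mul_atTop w.re (b := π * z.re / 2) (by positivity)).isBigO
      refine Asymptotics.IsBigO.of_bound 1 ?_
      filter_upwards [Filter.eventually_gt_atTop 0] with y hy
      rw [norm_cpow_eq_rpow_re_of_pos hy, one_mul]
      exact le_abs_self _
    refine (h2.mul h1).congr_right fun y => ?_
    rw [← Real.exp_add]
    ring_nf
  exact (integrable_norm_iff ((hcont.mono Set.Ioi_subset_Ici_self).aestronglyMeasurable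
    measurableSet_Ioi)).mp (integrable_of_isBigO_exp_neg (by positivity) hcont.norm hO.norm_left)

theorem image_inv_Ioo_zero_one : (fun u : ℝ => u⁻¹) '' Set.Ioo 0 1 = Set.Ioi 1 := by
  ext y
  constructor
  · rintro ⟨u, ⟨h0, h1⟩, rfl⟩
    exact (one_lt_inv₀ h0).mpr h1
  · intro hy
    have hy0 : (0 : ℝ) < y := zero_lt_one.trans hy
    exact ⟨y⁻¹, ⟨inv_pos.mpr hy0, inv_lt_one_of_one_lt₀ hy⟩, inv_inv y⟩

theorem hasDerivWithinAt_inv_Ioo (u : ℝ) (hu : u ∈ Set.Ioo (0 : ℝ) 1) :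
    HasDerivWithinAt (fun u : ℝ => u⁻¹) (-(u ^ 2)⁻¹) (Set.Ioo 0 1) u :=
  (hasDerivAt_inv hu.1.ne').hasDerivWithinAt

theorem integral_Ioi_one_eq_integral_Ioo (g : ℝ → ℂ) :
    ∫ y in Set.Ioi (1 : ℝ), g y = ∫ u in Set.Ioo (0 : ℝ) 1, |-(u ^ 2)⁻¹| • g u⁻¹ := by
  rw [← image_inv_Ioo_zero_one]
  exact integral_image_eq_integral_abs_deriv_smul measurableSet_Ioo hasDerivWithinAt_inv_Ioo
    inv_injective.injOn g

theorem integrableOn_Ioi_one_iff_integrableOn_Ioo (g : ℝ → ℂ) :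
    IntegrableOn g (Set.Ioi 1) ↔
      IntegrableOn (fun u : ℝ => |-(u ^ 2)⁻¹| • g u⁻¹) (Set.Ioo 0 1) := by
  rw [← image_inv_Ioo_zero_one]
  exact integrableOn_image_iff_integrableOn_abs_deriv_smul measurableSet_Ioo
    hasDerivWithinAt_inv_Ioo inv_injective.injOn g

theorem integrableOn_Ioo_cpow {w : ℂ} (hw : 0 < w.re) :
    IntegrableOn (fun u : ℝ => (u : ℂ) ^ (w - 1)) (Set.Ioo 0 1) := by
  have h := intervalIntegral.intervalIntegrable_cpow' (a := 0) (b := 1) (r := w - 1)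
    (by simpa using hw)
  exact ((intervalIntegrable_iff_integrableOn_Ioc_of_le zero_le_one).mp h).mono_set
    Set.Ioo_subset_Ioc_self

theorem integral_Ioo_cpow {w : ℂ} (hw : 0 < w.re) :
    ∫ u in Set.Ioo (0 : ℝ) 1, (u : ℂ) ^ (w - 1) = 1 / w := by
  have hw0 : w ≠ 0 := by rintro rfl; simp at hw
  rw [← integral_Ioc_eq_integral_Ioo, ← intervalIntegral.integral_of_le zero_le_one,
    integral_cpow (Or.inl (by simpa using hw))]
  simp [zero_cpow hw0]

theorem inv_cpow_of_re_pos {z : ℂ} (hz : 0 < z.re) (w : ℂ) : z⁻¹ ^ w = z ^ (-w) := by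
  rw [inv_cpow _ _ fun h => ?_, cpow_neg]
  have := (arg_eq_pi_iff.mp h).1
  linarith

theorem lower_integral_transformed (τ s : ℂ) (hτ : 0 < τ.re) (hs : 1 < s.re) :
    ∫ u in Set.Ioo (0 : ℝ) 1, (τ * u) ^ (s / 2) * psiC (τ * u) / (u : ℂ) =
      -τ ^ (s / 2) / s - τ ^ (-(1 - s) / 2) / (1 - s)
        + ∫ y in Set.Ioi (1 : ℝ), ((y : ℂ) / τ) ^ ((1 - s) / 2) * psiC (y / τ) / (y : ℂ) := by
  have hτ0 : τ ≠ 0 := by rintro rfl; simp at hτ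
  have hs2 : 0 < (s / 2).re := by
    rw [div_ofNat_re]; linarith
  have hs1 : 0 < ((s - 1) / 2).re := by
    rw [div_ofNat_re, sub_re, one_re]; linarith
  set g : ℝ → ℂ := fun y => ((y : ℂ) / τ) ^ ((1 - s) / 2) * psiC (y / τ) / (y : ℂ) with hg
  have hgint : IntegrableOn g (Set.Ioi 1) := by
    refine IntegrableOn.congr_fun ((integrableOn_cpow_mul_psiC (inv_re_pos hτ)
      ((1 - s) / 2 - 1)).const_mul (τ⁻¹ ^ ((1 - s) / 2))) (fun y hy => ?_) measurableSet_Ioi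
    have hy0 : (0 : ℝ) < y := zero_lt_one.trans hy
    have hy' : (y : ℂ) ≠ 0 := ofReal_ne_zero.mpr hy0.ne'
    simp only [hg]
    rw [div_eq_mul_inv (y : ℂ) τ, mul_comm (y : ℂ) τ⁻¹,
      mul_ofReal_cpow_of_pos (inv_ne_zero hτ0) hy0, cpow_sub _ _ hy', cpow_one]
    ring
  have hpt : ∀ u ∈ Set.Ioo (0 : ℝ) 1, (τ * u) ^ (s / 2) * psiC (τ * u) / (u : ℂ) =
      τ ^ ((s - 1) / 2) / 2 * (u : ℂ) ^ ((s - 1) / 2 - 1) -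
        τ ^ (s / 2) / 2 * (u : ℂ) ^ (s / 2 - 1) + |-(u ^ 2)⁻¹| • g u⁻¹ := by
    rintro u ⟨hu, -⟩
    have hu' : (u : ℂ) ≠ 0 := ofReal_ne_zero.mpr hu.ne'
    have hre : 0 < (τ * u).re := by simpa using mul_pos hτ hu
    have hne : τ * u ≠ 0 := mul_ne_zero hτ0 hu'
    have e1 : ((u⁻¹ : ℝ) : ℂ) / τ = (τ * u)⁻¹ := by
      rw [ofReal_inv, mul_inv, div_eq_mul_inv, mul_comm]
    have e2 : |-(u ^ 2)⁻¹| = (u ^ 2)⁻¹ := by rw [abs_neg, abs_of_pos (by positivity)]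
    have e3 : -((1 - s) / 2) = (s - 1) / 2 := by ring
    have e4 : (s - 1) / 2 = s / 2 + -(1 / 2) := by ring
    have e5 : (τ * u) ^ ((s - 1) / 2) = (τ * u) ^ (s / 2) * (τ * u) ^ (-(1 / 2) : ℂ) := by
      rw [e4, cpow_add _ _ hne]
    simp only [hg, e1, e2, real_smul]
    rw [inv_cpow_of_re_pos hre, e3, psiC_functional_equation hre, cpow_sub _ _ hu',
      cpow_sub _ _ hu', cpow_one]
    have e6 := mul_ofReal_cpow_of_pos hτ0 hu (s / 2)
    have e7 := mul_ofReal_cpow_of_pos hτ0 hu ((s - 1) / 2)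
    have e8 : τ ^ ((s - 1) / 2) / 2 * ((u : ℂ) ^ ((s - 1) / 2) / u) -
        τ ^ (s / 2) / 2 * ((u : ℂ) ^ (s / 2) / u) =
        ((τ * u) ^ ((s - 1) / 2) - (τ * u) ^ (s / 2)) / 2 / u := by
      rw [e6, e7]; ring
    rw [e8, e5]
    push_cast
    field_simp
  have hA := (integrableOn_Ioo_cpow hs1).const_mul (τ ^ ((s - 1) / 2) / 2)
  have hB := (integrableOn_Ioo_cpow hs2).const_mul (τ ^ (s / 2) / 2)
  rw [setIntegral_congr_fun measurableSet_Ioo hpt,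
    integral_add (by exact hA.sub hB) ((integrableOn_Ioi_one_iff_integrableOn_Ioo g).mp hgint),
    integral_sub hA hB, integral_const_mul, integral_const_mul, integral_Ioo_cpow hs1,
    integral_Ioo_cpow hs2, ← integral_Ioi_one_eq_integral_Ioo]
  have hs0 : s ≠ 0 := by rintro rfl; simp at hs; linarith
  have h1 : s - 1 ≠ 0 := by
    intro h; rw [h] at hs1; simp at hs1
  have h2 : 1 - s ≠ 0 := by rw [← neg_sub]; exact neg_ne_zero.mpr h1
  have e : -(1 - s) / 2 = (s - 1) / 2 := by ring
  rw [e]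
  congr 1
  rw [← neg_sub s 1]
  field_simp
  ring
end

section
/- Let z be a complex number with Re(z) > 0, let a be a complex number that is not zero or a negative integer, and let c be a real number with c > 0 and c > -Re(a). Then the incomplete gamma function Γ(a, z) := z^a · ∫_{1}^{∞} x^{a-1} e^{-z x} dx admits the Mellin–Barnes representation Γ(a, z) = (1/(2π)) · ∫_{-∞}^{∞} Γ(c + it + a) · z^{-(c + it)} / (c + it) dt. -/
open MeasureTheory Complex Real

/-- The Mellin transform of the tail integrals of `h` at `s` is that of `h` at `s + 1`,
divided by `s`. -/
theorem hasMellin_integral_Ioi {h : ℝ → ℂ} {s : ℂ} (hs : 0 < s.re)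
    (hm : AEStronglyMeasurable h (volume.restrict (Set.Ioi 0)))
    (hh : MellinConvergent h (s + 1)) :
    HasMellin (fun y : ℝ ↦ ∫ x in Set.Ioi y, h x) s (mellin h (s + 1) / s) := by
  set μ : Measure ℝ := volume.restrict (Set.Ioi 0) with hμ
  set F : ℝ × ℝ → ℂ :=
    Set.indicator {p | p.1 < p.2} (fun p ↦ (p.1 : ℂ) ^ (s - 1) * h p.2) with hF
  have hFm : AEStronglyMeasurable F (μ.prod μ) := by
    refine AEStronglyMeasurable.indicator (AEStronglyMeasurable.mul ?_ hm.comp_snd)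
      (measurableSet_lt measurable_fst measurable_snd)
    exact (by fun_prop : Measurable fun p : ℝ × ℝ ↦ (p.1 : ℂ) ^ (s - 1)).aestronglyMeasurable
  have hFx (x : ℝ) : (fun y ↦ F (y, x)) =
      (Set.Iio x).indicator (fun y ↦ (y : ℂ) ^ (s - 1) * h x) := by
    ext y
    simp [hF, Set.indicator_apply]
  have hs0 : s ≠ 0 := by
    rintro rfl
    simp at hs
  have hre : -1 < (s - 1).re := by simpa using hs
  have hpow (x : ℝ) (hx : 0 < x) :
      IntegrableOn (fun y : ℝ ↦ (y : ℂ) ^ (s - 1)) (Set.Iio x ∩ Set.Ioi 0) := by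
    rw [Set.inter_comm, Set.Ioi_inter_Iio, ← integrableOn_Ioc_iff_integrableOn_Ioo,
      ← intervalIntegrable_iff_integrableOn_Ioc_of_le hx.le]
    exact intervalIntegral.intervalIntegrable_cpow' hre
  have hFint : Integrable F (μ.prod μ) := by
    rw [integrable_prod_iff' hFm]
    constructor
    · refine (ae_restrict_mem measurableSet_Ioi).mono fun x hx ↦ ?_
      rw [hFx, integrable_indicator_iff measurableSet_Iio, IntegrableOn, hμ,
        Measure.restrict_restrict measurableSet_Iio]
      exact (hpow x hx).mul_const _
    · have hn := (hh.norm).div_const s.re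
      refine hn.congr ((ae_restrict_mem measurableSet_Ioi).mono fun x (hx : 0 < x) ↦ ?_)
      have : (fun y ↦ ‖F (y, x)‖) =
          (Set.Iio x).indicator (fun y ↦ ‖(y : ℂ) ^ (s - 1)‖ * ‖h x‖) := by
        ext y
        rw [congrFun (hFx x) y, norm_indicator_eq_indicator_norm]
        simp
      simp only [this]
      rw [integral_indicator measurableSet_Iio, hμ, Measure.restrict_restrict measurableSet_Iio,
        integral_mul_const, Set.inter_comm, Set.Ioi_inter_Iio, ← integral_Ioc_eq_integral_Ioo,
        setIntegral_congr_fun (g := fun y : ℝ ↦ y ^ (s.re - 1)) measurableSet_Ioc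
          (fun y hy ↦ by simp [norm_cpow_eq_rpow_re_of_pos hy.1]),
        ← intervalIntegral.integral_of_le hx.le, integral_rpow (Or.inl (by linarith))]
      simp [norm_cpow_eq_rpow_re_of_pos hx, Real.zero_rpow hs.ne']
      ring
  have hFy (y : ℝ) (hy : 0 < y) :
      ∫ x, F (y, x) ∂μ = (y : ℂ) ^ (s - 1) • ∫ x in Set.Ioi y, h x := by
    have : (fun x ↦ F (y, x)) = (Set.Ioi y).indicator (fun x ↦ (y : ℂ) ^ (s - 1) * h x) := by
      ext x
      simp [hF, Set.indicator_apply]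
    rw [this, integral_indicator measurableSet_Ioi, hμ, Measure.restrict_restrict measurableSet_Ioi,
      Set.inter_eq_left.mpr (Set.Ioi_subset_Ioi hy.le), integral_const_mul, smul_eq_mul]
  refine ⟨hFint.integral_prod_left.congr
    ((ae_restrict_mem measurableSet_Ioi).mono fun y hy ↦ hFy y hy), ?_⟩
  calc mellin (fun y : ℝ ↦ ∫ x in Set.Ioi y, h x) s
      = ∫ y, ∫ x, F (y, x) ∂μ ∂μ :=
        (setIntegral_congr_fun measurableSet_Ioi fun y hy ↦ hFy y hy).symm
    _ = ∫ x, ∫ y, F (y, x) ∂μ ∂μ := integral_integral_swap hFint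
    _ = ∫ x : ℝ in Set.Ioi 0, ((x : ℂ) ^ (s + 1 - 1) • h x) / s := by
        refine setIntegral_congr_fun measurableSet_Ioi fun x (hx : 0 < x) ↦ ?_
        simp only [hFx]
        rw [integral_indicator measurableSet_Iio, hμ, Measure.restrict_restrict measurableSet_Iio,
          integral_mul_const, Set.inter_comm, Set.Ioi_inter_Iio, ← integral_Ioc_eq_integral_Ioo,
          ← intervalIntegral.integral_of_le hx.le, integral_cpow (Or.inl hre)]
        simp [Complex.zero_cpow hs0]
        ring
    _ = mellin h (s + 1) / s := integral_div _ _

theorem norm_cpow_mul_cexp_neg_mul {s z : ℂ} {t : ℝ} (ht : 0 < t) :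
    ‖(t : ℂ) ^ s * cexp (-z * t)‖ = t ^ s.re * Real.exp (-z.re * t) := by
  rw [norm_mul, norm_cpow_eq_rpow_re_of_pos ht, Complex.norm_exp]
  simp

theorem integrableOn_rpow_mul_exp_neg_mul {s b : ℝ} (hs : -1 < s) (hb : 0 < b) :
    IntegrableOn (fun t : ℝ ↦ t ^ s * Real.exp (-b * t)) (Set.Ioi 0) := by
  simpa using integrableOn_rpow_mul_exp_neg_mul_rpow hs one_pos hb

theorem integrableOn_cpow_mul_cexp_neg_mul {s z : ℂ} (hs : -1 < s.re) (hz : 0 < z.re) :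
    IntegrableOn (fun t : ℝ ↦ (t : ℂ) ^ s * cexp (-z * t)) (Set.Ioi 0) := by
  refine (integrableOn_rpow_mul_exp_neg_mul hs hz).mono'
    (by fun_prop : Measurable fun t : ℝ ↦ (t : ℂ) ^ s * cexp (-z * t)).aestronglyMeasurable
    ((ae_restrict_mem measurableSet_Ioi).mono fun t ht ↦ ?_)
  exact (norm_cpow_mul_cexp_neg_mul ht).le

theorem differentiableAt_integral_cpow_mul_cexp_neg_mul {s z : ℂ} (hs : -1 < s.re)
    (hz : 0 < z.re) :
    DifferentiableAt ℂ (fun w ↦ ∫ t : ℝ in Set.Ioi 0, (t : ℂ) ^ s * cexp (-w * t)) z := by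
  have hlt : z.re / 2 < z.re := by linarith
  refine (hasDerivAt_integral_of_dominated_loc_of_deriv_le (μ := volume.restrict (Set.Ioi 0))
    (F := fun w (t : ℝ) ↦ (t : ℂ) ^ s * cexp (-w * t))
    (F' := fun w t ↦ (t : ℂ) ^ s * (cexp (-w * t) * (-t)))
    (bound := fun t ↦ t ^ (s.re + 1) * Real.exp (-(z.re / 2) * t))
    ((isOpen_lt continuous_const Complex.continuous_re).mem_nhds hlt)
    (Filter.Eventually.of_forall fun w ↦ (by fun_prop : Measurable _).aestronglyMeasurable)
    (integrableOn_cpow_mul_cexp_neg_mul hs hz)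
    (by fun_prop : Measurable _).aestronglyMeasurable ?_
    (integrableOn_rpow_mul_exp_neg_mul (by linarith) (by linarith)) ?_).2.differentiableAt
  · refine (ae_restrict_mem measurableSet_Ioi).mono fun t (ht : 0 < t) w (hw : z.re / 2 < w.re) ↦ ?_
    rw [← mul_assoc, norm_mul, norm_cpow_mul_cexp_neg_mul ht, Real.rpow_add_one ht.ne', norm_neg,
      norm_real, Real.norm_of_nonneg ht.le, mul_right_comm]
    gcongr
  · refine Filter.Eventually.of_forall fun t w _ ↦ HasDerivAt.const_mul _ ?_
    simpa using ((hasDerivAt_id w).neg.mul_const (t : ℂ)).cexp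

/-- `integral_cpow_mul_exp_neg_mul_Ioi` for a complex parameter in the right half-plane. -/
theorem integral_cpow_mul_cexp_neg_mul_Ioi {s z : ℂ} (hs : 0 < s.re) (hz : 0 < z.re) :
    ∫ t : ℝ in Set.Ioi 0, (t : ℂ) ^ (s - 1) * cexp (-z * t) = z ^ (-s) * Complex.Gamma s := by
  have hopen : IsOpen {w : ℂ | 0 < w.re} := isOpen_lt continuous_const Complex.continuous_re
  have hs' : -1 < (s - 1).re := by simpa using hs
  have hf : AnalyticOnNhd ℂ
      (fun w ↦ ∫ t : ℝ in Set.Ioi 0, (t : ℂ) ^ (s - 1) * cexp (-w * t)) {w : ℂ | 0 < w.re} :=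
    DifferentiableOn.analyticOnNhd (fun w hw ↦
      (differentiableAt_integral_cpow_mul_cexp_neg_mul hs' hw).differentiableWithinAt) hopen
  have hg : AnalyticOnNhd ℂ (fun w : ℂ ↦ w ^ (-s) * Complex.Gamma s) {w : ℂ | 0 < w.re} :=
    DifferentiableOn.analyticOnNhd (fun w hw ↦
      ((differentiableAt_id.cpow_const (Or.inl hw)).mul_const _).differentiableWithinAt) hopen
  refine hf.eqOn_of_preconnected_of_frequently_eq hg
    (convex_halfSpace_re_gt 0).isPreconnected (z₀ := 1) (by simp) ?_ hz
  have hreal (r : ℝ) (hr : 0 < r) :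
      ∫ t : ℝ in Set.Ioi 0, (t : ℂ) ^ (s - 1) * cexp (-r * t) = (r : ℂ) ^ (-s) * Complex.Gamma s := by
    simp_rw [neg_mul]
    rw [integral_cpow_mul_exp_neg_mul_Ioi hs hr, one_div, Complex.inv_cpow, Complex.cpow_neg]
    rw [Complex.arg_ofReal_of_nonneg hr.le]
    exact Real.pi_pos.ne
  have htend : Filter.Tendsto (fun r : ℝ ↦ (r : ℂ)) (nhdsWithin 1 {1}ᶜ) (nhdsWithin 1 {1}ᶜ) := by
    refine tendsto_nhdsWithin_iff.mpr
      ⟨(Complex.continuous_ofReal.tendsto' 1 1 (by simp)).mono_left nhdsWithin_le_nhds, ?_⟩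
    filter_upwards [self_mem_nhdsWithin] with r hr
    simpa using hr
  refine htend.frequently (Filter.Eventually.frequently ?_)
  filter_upwards [nhdsWithin_le_nhds (lt_mem_nhds one_pos)] with r hr using hreal r hr

theorem integrable_inv_normSq_add_mul_I {w : ℂ} (hw : 0 < w.re) :
    Integrable (fun t : ℝ ↦ (‖w + t * I‖ ^ 2)⁻¹) := by
  have h := ((integrable_inv_one_add_sq.comp_mul_left' (inv_ne_zero hw.ne')).comp_add_right
    w.im).const_mul (w.re ^ 2)⁻¹
  refine h.congr (Filter.Eventually.of_forall fun t ↦ ?_)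
  have h1 : ‖w + t * I‖ ^ 2 = w.re ^ 2 + (t + w.im) ^ 2 := by
    rw [← Complex.normSq_eq_norm_sq, Complex.normSq_apply]
    simp
    ring
  have h2 : w.re ^ 2 + (t + w.im) ^ 2 ≠ 0 := by positivity
  have h3 := hw.ne'
  simp only [h1]
  rw [← mul_inv]
  congr 1
  field_simp

/-- The integrand of the Mellin–Barnes integral is integrable. -/
theorem integrable_cpow_mul_Gamma_div {z a s : ℂ} (hz : 0 < z.re) (hs : 0 < s.re)
    (hsa : 0 < (s + a).re) :
    Integrable (fun t : ℝ ↦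
      z ^ (-(s + t * I + a)) * Complex.Gamma (s + t * I + a) / (s + t * I)) := by
  have hz0 : z ≠ 0 := by
    rintro rfl
    simp at hz
  set C : ℝ := ‖z‖ * ∫ t : ℝ in Set.Ioi 0, t ^ (s + a).re * Real.exp (-z.re * t) with hC
  have hre (t : ℝ) : (s + t * I + a).re = (s + a).re := by simp
  have hre' (t : ℝ) : (s + t * I).re = s.re := by simp
  have hne (t : ℝ) : s + t * I + a ≠ 0 := by
    intro h
    rw [← hre t, h] at hsa
    simp at hsa
  have hne' (t : ℝ) : s + t * I ≠ 0 := by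
    intro h
    rw [← hre' t, h] at hs
    simp at hs
  have hbound (t : ℝ) : ‖z ^ (-(s + t * I + a)) * Complex.Gamma (s + t * I + a)‖ ≤
      C / ‖(s + a) + t * I‖ := by
    set w := s + t * I + a with hw
    have hwp : 0 < (w + 1).re := by
      rw [add_re, hre]
      simp only [one_re]
      linarith
    have key : z ^ (-w) * Complex.Gamma w * w =
        z * ∫ x : ℝ in Set.Ioi 0, (x : ℂ) ^ w * cexp (-z * x) := by
      have := integral_cpow_mul_cexp_neg_mul_Ioi hwp hz
      rw [add_sub_cancel_right] at this
      rw [this, Complex.Gamma_add_one _ (hne t), neg_add w, Complex.cpow_add (-w) _ hz0,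
        Complex.cpow_neg_one, ← hw]
      field_simp
    rw [show s + a + t * I = w by rw [hw]; ring, le_div_iff₀ (norm_pos_iff.mpr (hne t)),
      ← norm_mul, key, norm_mul, hC]
    gcongr
    refine (norm_integral_le_integral_norm _).trans_eq
      (setIntegral_congr_fun measurableSet_Ioi fun x hx ↦ ?_)
    rw [norm_cpow_mul_cexp_neg_mul hx, hre]
  have hcont : Continuous fun t : ℝ ↦
      z ^ (-(s + t * I + a)) * Complex.Gamma (s + t * I + a) / (s + t * I) := by
    refine Continuous.div (Continuous.mul ?_ ?_) (by fun_prop) hne'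
    · exact Continuous.const_cpow (by fun_prop) (Or.inl hz0)
    · refine continuous_iff_continuousAt.mpr fun t ↦ ContinuousAt.comp (g := Complex.Gamma) ?_
        (by fun_prop)
      refine (Complex.differentiableAt_Gamma _ fun m h ↦ ?_).continuousAt
      rw [← hre t, h, neg_re, natCast_re] at hsa
      linarith [m.cast_nonneg (α := ℝ)]
  refine (((integrable_inv_normSq_add_mul_I hsa).add
    (integrable_inv_normSq_add_mul_I hs)).const_mul C).mono' hcont.aestronglyMeasurable
    (Filter.Eventually.of_forall fun t ↦ ?_)
  have hC0 : 0 ≤ C := mul_nonneg (norm_nonneg _)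
    (setIntegral_nonneg measurableSet_Ioi fun t (ht : 0 < t) ↦ by positivity)
  rw [norm_div]
  calc _ ≤ C / ‖(s + a) + t * I‖ / ‖s + t * I‖ := by gcongr; exact hbound t
    _ = C * (‖(s + a) + t * I‖⁻¹ * ‖s + t * I‖⁻¹) := by ring
    _ ≤ _ := by
      gcongr
      simp only [Pi.add_apply, ← inv_pow]
      nlinarith [sq_nonneg (‖(s + a) + t * I‖⁻¹ - ‖s + t * I‖⁻¹),
        sq_nonneg (‖(s + a) + t * I‖⁻¹), sq_nonneg (‖s + t * I‖⁻¹)]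

/-- Mellin transform of the (unnormalised) incomplete Gamma integral. -/
theorem hasMellin_integral_Ioi_cpow_mul_cexp {z a s : ℂ} (hz : 0 < z.re) (hs : 0 < s.re)
    (hsa : 0 < (s + a).re) :
    HasMellin (fun y : ℝ ↦ ∫ x in Set.Ioi y, (x : ℂ) ^ (a - 1) * cexp (-z * x)) s
      (z ^ (-(s + a)) * Complex.Gamma (s + a) / s) := by
  have hpt : Set.EqOn (fun x : ℝ ↦ (x : ℂ) ^ (s + 1 - 1) • ((x : ℂ) ^ (a - 1) * cexp (-z * x)))
      (fun x : ℝ ↦ (x : ℂ) ^ (s + a - 1) * cexp (-z * x)) (Set.Ioi 0) := fun x (hx : 0 < x) ↦ by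
    simp only
    rw [smul_eq_mul, ← mul_assoc, ← Complex.cpow_add _ _ (ofReal_ne_zero.mpr hx.ne')]
    ring_nf
  rw [← integral_cpow_mul_cexp_neg_mul_Ioi hsa hz,
    ← setIntegral_congr_fun measurableSet_Ioi hpt]
  refine hasMellin_integral_Ioi hs (by fun_prop : Measurable _).aestronglyMeasurable ?_
  exact (integrableOn_congr_fun hpt measurableSet_Ioi).mpr
    (integrableOn_cpow_mul_cexp_neg_mul (by simpa using hsa) hz)

theorem mellin_barnes_incomplete_gamma (z a : ℂ) (hz : 0 < z.re)
    (ha : ∀ n : ℕ, a ≠ -(n : ℂ)) (c : ℝ) (hc0 : 0 < c) (hca : -a.re < c) :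
    z ^ a * ∫ x in Set.Ioi (1 : ℝ), (x : ℂ) ^ (a - 1) * Complex.exp (-z * x) =
      (1 / (2 * (π : ℂ))) *
        ∫ t : ℝ,
          Complex.Gamma ((c : ℂ) + t * Complex.I + a) * z ^ (-((c : ℂ) + t * Complex.I)) /
            ((c : ℂ) + t * Complex.I) := by
  have hz0 : z ≠ 0 := by
    rintro rfl
    simp at hz
  set f : ℝ → ℂ := fun y ↦ ∫ x in Set.Ioi y, (x : ℂ) ^ (a - 1) * cexp (-z * x) with hf
  have hmellin (t : ℝ) := hasMellin_integral_Ioi_cpow_mul_cexp (z := z) (a := a)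
    (s := (c : ℂ) + t * I) hz (by simpa using hc0) (by simp; linarith)
  have hconv : MellinConvergent f (c : ℂ) := by simpa [hf] using (hmellin 0).1
  have hvert : VerticalIntegrable (mellin f) c := by
    refine (integrable_cpow_mul_Gamma_div (z := z) (a := a) (s := c) hz (by simpa using hc0)
      (by simp; linarith)).congr (Filter.Eventually.of_forall fun t ↦ (hmellin t).2.symm)
  have hcont : ContinuousAt f 1 := by
    have hint : IntegrableOn (fun x : ℝ ↦ (x : ℂ) ^ (a - 1) * cexp (-z * x))
        (Set.Ioi (1 / 2)) := by
      have h := (integrableOn_cpow_mul_cexp_neg_mul (s := a + c - 1) (by simp; linarith) hz).mono_set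
        (Set.Ioi_subset_Ioi (by norm_num : (0 : ℝ) ≤ 1 / 2))
      refine (h.norm.const_mul ((1 / 2 : ℝ) ^ (-c))).mono'
        (by fun_prop : Measurable _).aestronglyMeasurable
        ((ae_restrict_mem measurableSet_Ioi).mono fun x (hx : 1 / 2 < x) ↦ ?_)
      have hx0 : 0 < x := by linarith
      rw [norm_cpow_mul_cexp_neg_mul hx0, norm_cpow_mul_cexp_neg_mul hx0, ← mul_assoc,
        show (a - 1).re = -c + (a + c - 1).re by simp; ring, Real.rpow_add hx0]
      gcongr ?_ * _ * _
      exact Real.rpow_le_rpow_of_nonpos (by norm_num) hx.le (by linarith)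
    exact hint.continuousOn_Ici_primitive_Ioi.continuousAt
      (Ici_mem_nhds (by norm_num))
  have hinv := mellinInv_mellin_eq c f one_pos hconv hvert hcont
  simp only [hf] at hinv
  rw [← hinv, mellinInv, real_smul, mul_left_comm, ← integral_const_mul]
  push_cast
  congr 2
  ext t
  rw [(hmellin t).2, one_cpow, one_smul, neg_add, Complex.cpow_add _ _ hz0,
    Complex.cpow_neg z a]
  have : z ^ a ≠ 0 := by simp [hz0]
  field_simp
end

section
/- For every real number t, the completed Riemann zeta function satisfies Λ(1/2 + it) = 𝓛(1/2 + it) + conj(𝓛(1/2 + it)), i.e. Λ(1/2 + it) = 2·Re(𝓛(1/2 + it)); in particular Λ(1/2 + it) is real. (Equivalently, the Riemann–Siegel function satisfies Z(t) = 2·Re{e^{iϑ(t)}·L(1/2+it)}, where L(s) = π^{s/2}𝓛(s)/Γ(s/2).) -/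
open MeasureTheory Complex Real

/-- The completed Lavrik function `𝓛Λ(s) = -1/s + ∫_1^∞ x^{s/2-1} ψ(x) dx`. -/
noncomputable def LavrikLambda (s : ℂ) : ℂ :=
  -1 / s + ∫ x in Set.Ioi (1 : ℝ), (x : ℂ) ^ (s / 2 - 1) * psiC x

/-- On the positive reals, `2 ψ(x) = θ(x) - 1`, where `θ` is the even Hurwitz kernel at `0`. -/
lemma two_mul_psiC_ofReal {x : ℝ} (hx : 0 < x) :
    2 * psiC x = ((HurwitzZeta.evenKernel 0 x - 1 : ℝ) : ℂ) := by
  have h := HurwitzZeta.hasSum_nat_cosKernel₀ 0 hx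
  rw [AddCircle.coe_zero, ← HurwitzZeta.evenKernel_eq_cosKernel_of_zero, ← hasSum_ofReal] at h
  rw [← h.tsum_eq, psiC, ← tsum_mul_left]
  refine tsum_congr fun n => ?_
  simp

lemma conj_psiC_ofReal {x : ℝ} (hx : 0 < x) : (starRingEnd ℂ) (psiC x) = psiC x := by
  have h : psiC x = (((HurwitzZeta.evenKernel 0 x - 1) / 2 : ℝ) : ℂ) := by
    rw [ofReal_div, ← two_mul_psiC_ofReal hx]
    simp
  rw [h, conj_ofReal]

lemma LavrikLambda_conj (s : ℂ) :
    LavrikLambda ((starRingEnd ℂ) s) = (starRingEnd ℂ) (LavrikLambda s) := by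
  rw [LavrikLambda, LavrikLambda, map_add, ← integral_conj]
  congr 1
  · simp
  · refine setIntegral_congr_fun measurableSet_Ioi fun x hx => ?_
    have hx0 : (0 : ℝ) < x := zero_lt_one.trans hx
    have harg : (x : ℂ).arg ≠ π := by
      rw [arg_ofReal_of_nonneg hx0.le]
      exact pi_pos.ne
    have hpow := cpow_conj (x : ℂ) (s / 2 - 1) harg
    simp only [map_sub, map_div₀, map_ofNat, map_one, conj_ofReal] at hpow
    simp only [map_mul, conj_psiC_ofReal hx0, hpow]

/-- The entire part of a Mellin transform attached to a weak functional-equation pair, written as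
two Mellin transforms of functions supported on `(1, ∞)`. -/
lemma WeakFEPair.Λ₀_eq_mellin_indicator_add {E : Type*} [NormedAddCommGroup E] [NormedSpace ℂ E]
    (P : WeakFEPair E) (s : ℂ) :
    P.Λ₀ s = mellin ((Set.Ioi 1).indicator fun x => P.f x - P.f₀) s
      + P.ε • mellin ((Set.Ioi 1).indicator fun x => P.g x - P.g₀) (P.k - s) := by
  have hc : MellinConvergent P.f_modif s :=
    (P.isStrongFEPair_toStrongFEPair.hasMellin s).1
  set A := (Set.Ioi (1 : ℝ)).indicator fun x => P.f x - P.f₀ with hA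
  set B := (Set.Ioo (0 : ℝ) 1).indicator fun x => P.f x - (P.ε * ↑(x ^ (-P.k))) • P.g₀ with hB
  set G := (Set.Ioi (1 : ℝ)).indicator fun x => P.g x - P.g₀ with hG
  have hAB : P.f_modif = A + B := rfl
  have hcA : MellinConvergent A s := by
    have h := hc.indicator (measurableSet_Ioi (a := (1 : ℝ)))
    refine h.congr (Filter.Eventually.of_forall fun x => ?_)
    by_cases hx : x ∈ Set.Ioi (1 : ℝ)
    · have hx' : x ∉ Set.Ioo (0 : ℝ) 1 := fun h => lt_asymm h.2 hx
      simp [hAB, hB, Set.indicator_of_mem hx, Set.indicator_of_notMem hx']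
    · simp [hA, Set.indicator_of_notMem hx]
  have hcB : MellinConvergent B s := by
    refine (hc.sub hcA).congr (Filter.Eventually.of_forall fun x => ?_)
    simp [hAB]
  have hBG : mellin B s = P.ε • mellin G (P.k - s) := by
    have h1 : mellin B s = mellin (fun x : ℝ => P.ε • (x : ℂ) ^ (-P.k : ℂ) • G x⁻¹) s := by
      refine setIntegral_congr_fun measurableSet_Ioi fun x (hx : 0 < x) => ?_
      by_cases hx1 : x < 1
      · have hx' : x⁻¹ ∈ Set.Ioi (1 : ℝ) := (one_lt_inv₀ hx).2 hx1
        have hf : P.f x = (P.ε * ↑(x ^ (-P.k))) • P.g x⁻¹ := by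
          have := P.h_feq x⁻¹ (inv_pos.2 hx)
          rwa [one_div, inv_inv, inv_rpow hx.le, ← rpow_neg hx.le] at this
        simp only [hB, hG, Set.indicator_of_mem hx', Set.indicator_of_mem (Set.mem_Ioo.2 ⟨hx, hx1⟩)]
        rw [hf, ← smul_sub, mul_smul, ofReal_cpow hx.le, ofReal_neg]
      · have hx' : x⁻¹ ∉ Set.Ioi (1 : ℝ) := fun h => hx1 ((one_lt_inv₀ hx).1 h)
        have hx'' : x ∉ Set.Ioo (0 : ℝ) 1 := fun h => hx1 h.2
        simp [hB, hG, Set.indicator_of_notMem hx', Set.indicator_of_notMem hx'']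
    rw [h1, mellin_const_smul, mellin_cpow_smul, mellin_comp_inv]
    congr 2
    ring
  rw [← hBG]
  exact (hasMellin_add hcA hcB).2

/-- Symmetric Riemann–Lavrik representation: `Λ(s) = 𝓛(s) + 𝓛(1 - s)`. -/
lemma completedRiemannZeta_eq_LavrikLambda_add (s : ℂ) :
    completedRiemannZeta s = LavrikLambda s + LavrikLambda (1 - s) := by
  have hpsi (w : ℂ) : mellin ((Set.Ioi (1 : ℝ)).indicator fun x =>
      ((HurwitzZeta.evenKernel 0 x : ℝ) : ℂ) - 1) w
      = 2 * ∫ x in Set.Ioi (1 : ℝ), (x : ℂ) ^ (w - 1) * psiC x := by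
    simp_rw [mellin, ← Set.indicator_smul]
    rw [setIntegral_indicator measurableSet_Ioi,
      Set.inter_eq_right.2 (Set.Ioi_subset_Ioi zero_le_one), ← integral_const_mul]
    refine setIntegral_congr_fun measurableSet_Ioi fun x hx => ?_
    have h := two_mul_psiC_ofReal (zero_lt_one.trans hx)
    push_cast at h
    simp only [smul_eq_mul, ← h]
    ring
  have h0 : completedRiemannZeta₀ s =
      (∫ x in Set.Ioi (1 : ℝ), (x : ℂ) ^ (s / 2 - 1) * psiC x)
        + ∫ x in Set.Ioi (1 : ℝ), (x : ℂ) ^ ((1 - s) / 2 - 1) * psiC x := by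
    rw [completedRiemannZeta₀, HurwitzZeta.completedHurwitzZetaEven₀,
      WeakFEPair.Λ₀_eq_mellin_indicator_add]
    simp only [HurwitzZeta.hurwitzEvenFEPair, Function.comp_apply, if_true,
      ← HurwitzZeta.evenKernel_eq_cosKernel_of_zero, hpsi, one_smul]
    rw [show ((1 / 2 : ℝ) : ℂ) - s / 2 = (1 - s) / 2 by push_cast; ring]
    ring
  rw [completedRiemannZeta_eq, h0, LavrikLambda, LavrikLambda]
  ring

theorem completed_zeta_critical_line (t : ℝ) :
    completedRiemannZeta (1 / 2 + t * Complex.I) =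
        LavrikLambda (1 / 2 + t * Complex.I)
          + (starRingEnd ℂ) (LavrikLambda (1 / 2 + t * Complex.I))
      ∧ completedRiemannZeta (1 / 2 + t * Complex.I) =
          2 * ((LavrikLambda (1 / 2 + t * Complex.I)).re : ℂ)
      ∧ (completedRiemannZeta (1 / 2 + t * Complex.I)).im = 0 := by
  have hconj : (1 : ℂ) - (1 / 2 + t * Complex.I)
      = (starRingEnd ℂ) (1 / 2 + t * Complex.I) := by
    simp only [map_add, map_mul, map_div₀, map_one, map_ofNat, conj_ofReal, conj_I]
    ring
  have h := completedRiemannZeta_eq_LavrikLambda_add (1 / 2 + t * Complex.I)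
  rw [hconj, LavrikLambda_conj] at h
  have h2 := h
  rw [add_conj] at h2
  push_cast at h2
  refine ⟨h, h2, ?_⟩
  rw [h]
  simp
end

section
/- The function G(s) := -1 + s·∫_{1}^{∞} x^{s/2 - 1}·ψ(x) dx is an entire function of the complex variable s (it is complex differentiable at every point of ℂ). -/
open MeasureTheory Complex Real

/-- For real `x ≥ 1`, `ψ x = ∑_{n ≥ 1} exp (-π n² x)`. -/
noncomputable def psiR (x : ℝ) : ℝ := ∑' n : ℕ, Real.exp (-π * ((n : ℝ) + 1) ^ 2 * x)

theorem exp_neg_pi_mul_sq_le (n : ℕ) {x : ℝ} (hx : 1 ≤ x) :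
    Real.exp (-π * ((n : ℝ) + 1) ^ 2 * x) ≤ Real.exp (-(n : ℝ)) * Real.exp (-x) := by
  rw [← Real.exp_add]
  apply Real.exp_le_exp.mpr
  have hn : (0 : ℝ) ≤ n := n.cast_nonneg
  have h1 : (1 : ℝ) ≤ π := by linarith [Real.pi_gt_three]
  have h2 : ((n : ℝ) + 1) * x ≤ ((n : ℝ) + 1) ^ 2 * x := by
    gcongr
    nlinarith
  have h3 : ((n : ℝ) + 1) ^ 2 * x ≤ π * (((n : ℝ) + 1) ^ 2 * x) :=
    le_mul_of_one_le_left (by positivity) h1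
  nlinarith

theorem psiR_nonneg (x : ℝ) : 0 ≤ psiR x :=
  tsum_nonneg fun _ => (Real.exp_pos _).le

theorem psiR_le {x : ℝ} (hx : 1 ≤ x) :
    psiR x ≤ (∑' n : ℕ, Real.exp (-(n : ℝ))) * Real.exp (-x) := by
  have hs : Summable fun n : ℕ => Real.exp (-(n : ℝ)) * Real.exp (-x) :=
    Real.summable_exp_neg_nat.mul_right _
  rw [← tsum_mul_right]
  exact Summable.tsum_le_tsum (fun n => exp_neg_pi_mul_sq_le n hx)
    (Summable.of_nonneg_of_le (fun _ => (Real.exp_pos _).le)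
      (fun n => exp_neg_pi_mul_sq_le n hx) hs) hs

theorem continuousOn_psiR : ContinuousOn psiR (Set.Ioi 1) := by
  refine continuousOn_tsum (u := fun n : ℕ => Real.exp (-(n : ℝ))) (fun n => by fun_prop)
    Real.summable_exp_neg_nat fun n x hx => ?_
  have hx : (1 : ℝ) < x := hx
  rw [Real.norm_of_nonneg (Real.exp_pos _).le]
  refine (exp_neg_pi_mul_sq_le n hx.le).trans (mul_le_of_le_one_right (Real.exp_pos _).le ?_)
  exact Real.exp_le_one_iff.mpr (by linarith)

theorem integrableOn_psiR : IntegrableOn (fun x => (psiR x : ℂ)) (Set.Ioi 1) := by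
  have hexp : IntegrableOn (fun x : ℝ => (∑' n : ℕ, Real.exp (-(n : ℝ))) * Real.exp (-x))
      (Set.Ioi 1) := (integrableOn_exp_neg_Ioi 1).const_mul _
  refine (hexp.mono' (continuousOn_psiR.aestronglyMeasurable measurableSet_Ioi) ?_).ofReal
  refine (ae_restrict_mem measurableSet_Ioi).mono fun x hx => ?_
  rw [Real.norm_of_nonneg (psiR_nonneg x)]
  exact psiR_le (le_of_lt hx)

theorem differentiable_mellin_indicator_psiR :
    Differentiable ℂ (mellin ((Set.Ioi (1 : ℝ)).indicator fun x => (psiR x : ℂ))) := by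
  intro s
  refine mellin_differentiableAt_of_isBigO_rpow_exp (a := 1) (b := s.re - 1) one_pos ?_ ?_ ?_
    (by linarith)
  · exact (integrableOn_psiR.integrable_indicator measurableSet_Ioi).locallyIntegrable
      |>.locallyIntegrableOn _
  · refine Asymptotics.IsBigO.of_bound (∑' n : ℕ, Real.exp (-(n : ℝ))) ?_
    filter_upwards [Filter.eventually_gt_atTop (1 : ℝ)] with x hx
    rw [Set.indicator_of_mem (Set.mem_Ioi.mpr hx), Complex.norm_real,
      Real.norm_of_nonneg (psiR_nonneg x), Real.norm_of_nonneg (Real.exp_pos _).le, neg_one_mul]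
    exact psiR_le hx.le
  · refine Asymptotics.IsBigO.of_bound 0 ?_
    filter_upwards [mem_nhdsWithin_of_mem_nhds (Iio_mem_nhds one_pos)] with x hx
    rw [Set.indicator_of_notMem (by simpa using le_of_lt hx)]
    simp

theorem mellin_indicator_psiR (s : ℂ) :
    mellin ((Set.Ioi (1 : ℝ)).indicator fun x => (psiR x : ℂ)) s =
      ∫ x in Set.Ioi (1 : ℝ), (x : ℂ) ^ (s - 1) * (psiR x : ℂ) := by
  have h : (fun t : ℝ => (t : ℂ) ^ (s - 1) •
      (Set.Ioi (1 : ℝ)).indicator (fun x => (psiR x : ℂ)) t) =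
      (Set.Ioi (1 : ℝ)).indicator fun x => (x : ℂ) ^ (s - 1) * (psiR x : ℂ) := by
    ext t
    by_cases ht : t ∈ Set.Ioi (1 : ℝ) <;> simp [ht]
  rw [mellin, h, setIntegral_indicator measurableSet_Ioi,
    Set.inter_eq_right.mpr (Set.Ioi_subset_Ioi zero_le_one)]

theorem G_entire :
    Differentiable ℂ
      (fun s : ℂ =>
        -1 + s * ∫ x in Set.Ioi (1 : ℝ), (x : ℂ) ^ (s / 2 - 1) * (psiR x : ℂ)) := by
  simp_rw [← mellin_indicator_psiR]
  have h : Differentiable ℂ fun s : ℂ =>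
      mellin ((Set.Ioi (1 : ℝ)).indicator fun x => (psiR x : ℂ)) (s / 2) :=
    differentiable_mellin_indicator_psiR.comp (differentiable_id.div_const 2)
  exact (differentiable_const _).add (differentiable_id.mul h)
end

section
/- Let b₀ be the unique real zero of the entire function G(s) := -1 + s·∫_{1}^{∞} x^{s/2 - 1}·ψ(x) dx (restricted to real arguments, G(x) = x·Λ̃(x) has exactly one real zero b₀, with 11 < b₀ < 12). Then every complex zero of G lies in the half-plane Re(s) ≥ b₀: if G(s) = 0 then Re(s) ≥ b₀. -/
open MeasureTheory Complex Real

/-- The completed Lavrik function restricted to real arguments. -/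
noncomputable def LambdaR (x : ℝ) : ℝ :=
  -1 / x + ∫ y in Set.Ioi (1 : ℝ), y ^ (x / 2 - 1) * psiR y

lemma norm_cpow_mul_exp {x : ℝ} (hx : 0 < x) (c : ℂ) (a : ℝ) :
    ‖(x : ℂ) ^ c * (Real.exp (-a * x) : ℂ)‖ = x ^ c.re * Real.exp (-a * x) := by
  rw [norm_mul, Complex.norm_cpow_eq_rpow_re_of_pos hx, Complex.norm_real, Real.norm_eq_abs,
    Real.abs_exp]

lemma integrableOn_rpow_mul_exp_Ioi_one (c : ℝ) {a : ℝ} (ha : 0 < a) :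
    IntegrableOn (fun x : ℝ => x ^ c * Real.exp (-a * x)) (Set.Ioi 1) := by
  refine integrable_of_isBigO_exp_neg (b := a / 2) (half_pos ha) ?_ ?_
  · refine ContinuousOn.mul (fun x hx => ?_) (by fun_prop)
    exact (Real.continuousAt_rpow_const x c
      (Or.inl (zero_lt_one.trans_le hx).ne')).continuousWithinAt
  · have h := (isLittleO_rpow_exp_pos_mul_atTop c (half_pos ha)).isBigO.mul
      (Asymptotics.isBigO_refl (fun x : ℝ => Real.exp (-a * x)) Filter.atTop)
    refine h.congr_right fun x => ?_
    rw [← Real.exp_add]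
    ring_nf

lemma integrableOn_cpow_mul_exp_Ioi_one (c : ℂ) {a : ℝ} (ha : 0 < a) :
    IntegrableOn (fun x : ℝ => (x : ℂ) ^ c * (Real.exp (-a * x) : ℂ)) (Set.Ioi 1) := by
  refine (integrableOn_rpow_mul_exp_Ioi_one c.re ha).mono' ?_ ?_
  · refine ContinuousOn.aestronglyMeasurable (fun x hx => ?_) measurableSet_Ioi
    refine (ContinuousAt.mul ?_ (by fun_prop)).continuousWithinAt
    exact continuousAt_ofReal_cpow_const x c (Or.inr (zero_lt_one.trans hx).ne')
  · refine (ae_restrict_iff' measurableSet_Ioi).2 (.of_forall fun x hx => ?_)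
    exact (norm_cpow_mul_exp (zero_lt_one.trans hx) c a).le

/-- Integration by parts for the incomplete Mellin transform of `exp (-a x)`. -/
lemma mul_integral_cpow_mul_exp (s : ℂ) {a : ℝ} (ha : 0 < a) :
    2 * a * ∫ x in Set.Ioi (1 : ℝ), (x : ℂ) ^ (s / 2) * (Real.exp (-a * x) : ℂ) =
      s * (∫ x in Set.Ioi (1 : ℝ), (x : ℂ) ^ (s / 2 - 1) * (Real.exp (-a * x) : ℂ)) +
        2 * (Real.exp (-a) : ℂ) := by
  have i1 := (integrableOn_cpow_mul_exp_Ioi_one (s / 2 - 1) ha).const_mul (s / 2)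
  have i2 := (integrableOn_cpow_mul_exp_Ioi_one (s / 2) ha).const_mul (a : ℂ)
  have hexp : ∀ x : ℝ, HasDerivAt (fun x : ℝ => (Real.exp (-a * x) : ℂ))
      ((Real.exp (-a * x) * (-a) : ℝ) : ℂ) x := fun x => by
    have h : HasDerivAt (fun x : ℝ => Real.exp (-a * x)) (Real.exp (-a * x) * (-a)) x := by
      simpa using ((hasDerivAt_id x).const_mul (-a)).exp
    exact h.ofReal_comp
  have hpow : ∀ x : ℝ, 0 < x → HasDerivAt (fun x : ℝ => (x : ℂ) ^ (s / 2))
      (s / 2 * (x : ℂ) ^ (s / 2 - 1)) x := fun x hx => by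
    have h := (hasDerivAt_id (x : ℂ)).cpow_const (c := s / 2)
      (Complex.ofReal_mem_slitPlane.2 hx)
    simpa using h.comp_ofReal
  have hd : ∀ x ∈ Set.Ici (1 : ℝ), HasDerivAt
      (fun x : ℝ => (x : ℂ) ^ (s / 2) * (Real.exp (-a * x) : ℂ))
      (s / 2 * ((x : ℂ) ^ (s / 2 - 1) * (Real.exp (-a * x) : ℂ)) -
        a * ((x : ℂ) ^ (s / 2) * (Real.exp (-a * x) : ℂ))) x := fun x hx => by
    refine ((hpow x (zero_lt_one.trans_le hx)).mul (hexp x)).congr_deriv ?_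
    push_cast
    ring
  have hlim : Filter.Tendsto (fun x : ℝ => (x : ℂ) ^ (s / 2) * (Real.exp (-a * x) : ℂ))
      Filter.atTop (nhds 0) := by
    refine tendsto_zero_iff_norm_tendsto_zero.2 ?_
    refine (tendsto_rpow_mul_exp_neg_mul_atTop_nhds_zero (s / 2).re a ha).congr' ?_
    filter_upwards [Filter.eventually_gt_atTop 0] with x hx
    exact (norm_cpow_mul_exp hx _ a).symm
  have h := integral_Ioi_of_hasDerivAt_of_tendsto' hd (i1.sub i2) hlim
  rw [integral_sub i1 i2, integral_const_mul, integral_const_mul] at h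
  simp only [Complex.ofReal_one, Complex.one_cpow, mul_one, one_mul] at h
  linear_combination (-2) * h

lemma exp_neg_pi_sq_le (n : ℕ) {x : ℝ} (hx : 1 ≤ x) :
    Real.exp (-(π * ((n : ℝ) + 1) ^ 2) * x) ≤ Real.exp (-π) ^ n * Real.exp (-π * x) := by
  rw [← Real.exp_nat_mul, ← Real.exp_add, Real.exp_le_exp]
  have h1 : (n : ℝ) * 1 ≤ n * x := by gcongr
  have h2 : 0 ≤ π * ((n : ℝ) * x - n) := by
    have := Real.pi_pos
    exact mul_nonneg this.le (by linarith)
  have h3 : 0 ≤ π * (((n : ℝ) ^ 2 + n) * x) := by positivity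
  nlinarith

lemma summable_exp_neg_pi_pow : Summable fun n : ℕ => Real.exp (-π) ^ n :=
  summable_geometric_of_lt_one (Real.exp_pos _).le (by simpa using Real.pi_pos)

lemma hasSum_psiR {x : ℝ} (hx : 1 ≤ x) :
    HasSum (fun n : ℕ => Real.exp (-(π * ((n : ℝ) + 1) ^ 2) * x)) (psiR x) := by
  have h : Summable fun n : ℕ => Real.exp (-(π * ((n : ℝ) + 1) ^ 2) * x) :=
    .of_nonneg_of_le (fun _ => (Real.exp_pos _).le) (fun n => exp_neg_pi_sq_le n hx)
      (summable_exp_neg_pi_pow.mul_right _)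
  simpa only [psiR, neg_mul] using h.hasSum

lemma hasSum_integral_cpow_mul_psiR (c : ℂ) :
    HasSum (fun n : ℕ => ∫ x in Set.Ioi (1 : ℝ),
        (x : ℂ) ^ c * (Real.exp (-(π * ((n : ℝ) + 1) ^ 2) * x) : ℂ))
      (∫ x in Set.Ioi (1 : ℝ), (x : ℂ) ^ c * (psiR x : ℂ)) := by
  have ha : ∀ n : ℕ, 0 < π * ((n : ℝ) + 1) ^ 2 := fun n => by positivity
  have hs : Summable fun n : ℕ => ∫ x in Set.Ioi (1 : ℝ),
      ‖(x : ℂ) ^ c * (Real.exp (-(π * ((n : ℝ) + 1) ^ 2) * x) : ℂ)‖ := by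
    refine .of_nonneg_of_le (fun n => integral_nonneg fun x => norm_nonneg _) (fun n => ?_)
      (summable_exp_neg_pi_pow.mul_right
        (∫ x in Set.Ioi (1 : ℝ), x ^ c.re * Real.exp (-π * x)))
    rw [← integral_const_mul]
    refine setIntegral_mono_on (integrableOn_cpow_mul_exp_Ioi_one c (ha n)).norm
      ((integrableOn_rpow_mul_exp_Ioi_one c.re Real.pi_pos).const_mul _) measurableSet_Ioi
      fun x hx => ?_
    have hx0 : (0 : ℝ) < x := zero_lt_one.trans hx
    rw [norm_cpow_mul_exp hx0, mul_left_comm]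
    exact mul_le_mul_of_nonneg_left (exp_neg_pi_sq_le n (Set.mem_Ioi.1 hx).le)
      (Real.rpow_nonneg hx0.le _)
  have htsum : ∫ x in Set.Ioi (1 : ℝ), (x : ℂ) ^ c * (psiR x : ℂ) =
      ∫ x in Set.Ioi (1 : ℝ), ∑' n : ℕ,
        (x : ℂ) ^ c * (Real.exp (-(π * ((n : ℝ) + 1) ^ 2) * x) : ℂ) := by
    refine setIntegral_congr_fun measurableSet_Ioi fun x hx => ?_
    have hx1 : 1 ≤ x := (Set.mem_Ioi.1 hx).le
    exact ((Complex.hasSum_ofReal.2 (hasSum_psiR hx1)).mul_left _).tsum_eq.symm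
  rw [htsum]
  exact hasSum_integral_of_summable_integral_norm
    (fun n => integrableOn_cpow_mul_exp_Ioi_one c (ha n)) hs

/-- After integration by parts, a zero of `G` is a point where a Mellin-type series with positive
coefficients takes the value `1 + 2 ψ(1)`. -/
lemma hasSum_of_zero {s : ℂ}
    (hs : -1 + s * (∫ x in Set.Ioi (1 : ℝ), (x : ℂ) ^ (s / 2 - 1) * (psiR x : ℂ)) = 0) :
    HasSum (fun n : ℕ => 2 * ((π * ((n : ℝ) + 1) ^ 2 : ℝ) : ℂ) * ∫ x in Set.Ioi (1 : ℝ),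
        (x : ℂ) ^ (s / 2) * (Real.exp (-(π * ((n : ℝ) + 1) ^ 2) * x) : ℂ))
      ((1 + 2 * psiR 1 : ℝ) : ℂ) := by
  have h := ((hasSum_integral_cpow_mul_psiR (s / 2 - 1)).mul_left s).add
    ((Complex.hasSum_ofReal.2 (hasSum_psiR le_rfl)).mul_left 2)
  have hv : ((1 + 2 * psiR 1 : ℝ) : ℂ) =
      s * (∫ x in Set.Ioi (1 : ℝ), (x : ℂ) ^ (s / 2 - 1) * (psiR x : ℂ)) + 2 * (psiR 1 : ℂ) := by
    push_cast
    linear_combination -hs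
  rw [hv]
  have ha : ∀ n : ℕ, 0 < π * ((n : ℝ) + 1) ^ 2 := fun n => by positivity
  simp only [mul_integral_cpow_mul_exp s (ha _)]
  simpa only [mul_one] using h

lemma norm_integral_cpow_mul_exp_lt {c : ℂ} {b a : ℝ} (hcb : c.re < b) (ha : 0 < a) :
    ‖∫ x in Set.Ioi (1 : ℝ), (x : ℂ) ^ c * (Real.exp (-a * x) : ℂ)‖ <
      ∫ x in Set.Ioi (1 : ℝ), x ^ b * Real.exp (-a * x) := by
  have hlt : ∀ x ∈ Set.Ioi (1 : ℝ),
      x ^ c.re * Real.exp (-a * x) < x ^ b * Real.exp (-a * x) := fun x hx =>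
    mul_lt_mul_of_pos_right (Real.rpow_lt_rpow_of_exponent_lt hx hcb) (Real.exp_pos _)
  calc _ ≤ ∫ x in Set.Ioi (1 : ℝ), ‖(x : ℂ) ^ c * (Real.exp (-a * x) : ℂ)‖ :=
        norm_integral_le_integral_norm _
    _ = ∫ x in Set.Ioi (1 : ℝ), x ^ c.re * Real.exp (-a * x) :=
        setIntegral_congr_fun measurableSet_Ioi fun x hx =>
          norm_cpow_mul_exp (zero_lt_one.trans hx) c a
    _ < _ := by
        have i1 := integrableOn_rpow_mul_exp_Ioi_one c.re ha
        have i2 := integrableOn_rpow_mul_exp_Ioi_one b ha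
        rw [← sub_pos, ← integral_sub i2 i1, setIntegral_pos_iff_support_of_nonneg_ae
          ((ae_restrict_iff' measurableSet_Ioi).2
            (.of_forall fun x hx => (sub_pos.2 (hlt x hx)).le)) (i2.sub i1)]
        refine lt_of_lt_of_le (b := volume (Set.Ioi (1 : ℝ))) (by simp) (measure_mono fun x hx => ?_)
        exact ⟨(sub_pos.2 (hlt x hx)).ne', hx⟩

lemma integral_ofReal_cpow_mul (c : ℝ) (f : ℝ → ℝ) :
    ∫ x in Set.Ioi (1 : ℝ), (x : ℂ) ^ (c : ℂ) * (f x : ℂ) =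
      ((∫ x in Set.Ioi (1 : ℝ), x ^ c * f x : ℝ) : ℂ) := by
  rw [← integral_complex_ofReal]
  refine setIntegral_congr_fun measurableSet_Ioi fun x hx => ?_
  simp [Complex.ofReal_cpow (zero_lt_one.trans hx).le]

theorem zeros_in_half_plane (b₀ : ℝ) (hb₀ : LambdaR b₀ = 0) (hb₁ : 11 < b₀) (hb₂ : b₀ < 12) :
    ∀ s : ℂ,
      -1 + s * (∫ x in Set.Ioi (1 : ℝ), (x : ℂ) ^ (s / 2 - 1) * (psiR x : ℂ)) = 0 →
        b₀ ≤ s.re := by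
  intro s hs
  by_contra! hlt
  have hb : -1 + (b₀ : ℂ) *
      (∫ x in Set.Ioi (1 : ℝ), (x : ℂ) ^ ((b₀ : ℂ) / 2 - 1) * (psiR x : ℂ)) = 0 := by
    have h := integral_ofReal_cpow_mul (b₀ / 2 - 1) psiR
    push_cast at h
    rw [h]
    have hne : b₀ ≠ 0 := by linarith
    have h0 : -1 + b₀ * ∫ x in Set.Ioi (1 : ℝ), x ^ (b₀ / 2 - 1) * psiR x = 0 := by
      have h := congrArg (b₀ * ·) hb₀
      simp only [LambdaR, mul_add, mul_div_cancel₀ _ hne, mul_zero] at h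
      exact h
    exact_mod_cast h0
  have hB : HasSum (fun n : ℕ => 2 * (π * ((n : ℝ) + 1) ^ 2) * ∫ x in Set.Ioi (1 : ℝ),
      x ^ (b₀ / 2) * Real.exp (-(π * ((n : ℝ) + 1) ^ 2) * x)) (1 + 2 * psiR 1) := by
    rw [← Complex.hasSum_ofReal]
    convert hasSum_of_zero hb using 2 with n
    have h := integral_ofReal_cpow_mul (b₀ / 2)
      fun x => Real.exp (-(π * ((n : ℝ) + 1) ^ 2) * x)
    rw [show (b₀ : ℂ) / 2 = ((b₀ / 2 : ℝ) : ℂ) by push_cast; rfl, h]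
    simp only [Complex.ofReal_mul, Complex.ofReal_ofNat]
  have hS := hasSum_of_zero hs
  have hterm : ∀ n : ℕ, ‖2 * ((π * ((n : ℝ) + 1) ^ 2 : ℝ) : ℂ) * ∫ x in Set.Ioi (1 : ℝ),
        (x : ℂ) ^ (s / 2) * (Real.exp (-(π * ((n : ℝ) + 1) ^ 2) * x) : ℂ)‖ <
      2 * (π * ((n : ℝ) + 1) ^ 2) * ∫ x in Set.Ioi (1 : ℝ),
        x ^ (b₀ / 2) * Real.exp (-(π * ((n : ℝ) + 1) ^ 2) * x) := fun n => by
    have ha : 0 < π * ((n : ℝ) + 1) ^ 2 := by positivity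
    have hre : (s / 2).re < b₀ / 2 := by
      rw [Complex.div_ofNat_re]
      linarith
    rw [norm_mul, norm_mul, Complex.norm_real, Real.norm_of_nonneg ha.le, Complex.norm_ofNat]
    exact mul_lt_mul_of_pos_left (norm_integral_cpow_mul_exp_lt hre ha) (by positivity)
  have hN := Summable.of_nonneg_of_le (fun n => norm_nonneg _) (fun n => (hterm n).le) hB.summable
  have h1 := norm_tsum_le_tsum_norm hN
  have h2 := hN.tsum_lt_tsum (fun n => (hterm n).le) (hterm 0) hB.summable
  rw [hS.tsum_eq, Complex.norm_real] at h1
  rw [hB.tsum_eq] at h2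
  exact absurd (h1.trans_lt h2) (le_abs_self _).not_gt
end
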